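/- arXiv:2306.14849 — 2 statements merged into one kernel-verified Lean document; each statement's English description precedes it below -/
import Mathlib

section
/- As x → ∞ one has the asymptotic expansion ν(x) = e^x − 1/log x + γ_EM/(log x)² − (γ_EM² − π²/6)/(log x)³ + O(1/(log x)⁴); that is, the function x ↦ ν(x) − e^x + 1/log x − γ_EM/(log x)² + (γ_EM² − π²/6)/(log x)³ is big-O of (log x)^{−4} as x tends to infinity. -/
open MeasureTheory Real Asymptotics

/-- The Volterra function `ν(x) = ∫₀^∞ x^s / Γ(s+1) ds` (for `x > 0`; `ν(0) = 0`). -/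
noncomputable def volterra (x : ℝ) : ℝ := ∫ s in Set.Ioi (0 : ℝ), x ^ s / Real.Gamma (s + 1)

/-- The Euler–Mascheroni constant `γ_EM = −∫₀^∞ e^{−x} log x dx`. -/
noncomputable def eulerGamma : ℝ := -∫ x in Set.Ioi (0 : ℝ), Real.exp (-x) * Real.log x


/-- An entire function differs from its value at `0` by `z` times an entire function. -/
lemma exists_entire_quotient {f : ℂ → ℂ} (hf : Differentiable ℂ f) :
    ∃ g : ℂ → ℂ, Differentiable ℂ g ∧ (∀ z, f z = f 0 + z * g z) ∧ g 0 = deriv f 0 := by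
  refine ⟨dslope f 0, ?_, fun z => ?_, dslope_same f 0⟩
  · rw [← differentiableOn_univ, Complex.differentiableOn_dslope Filter.univ_mem]
    exact hf.differentiableOn
  · have := sub_smul_dslope f 0 z
    simp only [sub_zero, smul_eq_mul] at this
    rw [this]; ring

lemma hasDerivAt_complex_Gamma_one : HasDerivAt Complex.Gamma (-(eulerGamma : ℂ)) 1 := by
  have h := Complex.hasDerivAt_GammaIntegral (s := 1) (by simp)
  have hint : (∫ t : ℝ in Set.Ioi 0, (t : ℂ) ^ ((1 : ℂ) - 1) * (Real.log t * Real.exp (-t)))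
      = -(eulerGamma : ℂ) := by
    unfold eulerGamma
    rw [Complex.ofReal_neg, neg_neg, ← integral_complex_ofReal]
    congr 1
    ext t
    simp [mul_comm]
  rw [hint] at h
  refine h.congr_of_eventuallyEq ?_
  have : {s : ℂ | 0 < s.re} ∈ nhds (1 : ℂ) :=
    (isOpen_lt continuous_const Complex.continuous_re).mem_nhds (by simp)
  filter_upwards [this] with s hs using Complex.Gamma_eq_integral hs

lemma deriv_inv_Gamma_one_sub_zero :
    deriv (fun z : ℂ => (Complex.Gamma (1 - z))⁻¹) 0 = -(eulerGamma : ℂ) := by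
  have h1 : HasDerivAt (fun z : ℂ => 1 - z) (-1) 0 := by
    simpa using (hasDerivAt_id (0 : ℂ)).const_sub 1
  have h2 : HasDerivAt Complex.Gamma (-(eulerGamma : ℂ)) (1 - 0) := by
    simpa using hasDerivAt_complex_Gamma_one
  have h3 := (h2.comp (0 : ℂ) h1).inv (by simp)
  have h4 := h3.deriv
  simp only [Function.comp_apply, sub_zero, Complex.Gamma_one] at h4
  rw [show (fun z : ℂ => (Complex.Gamma (1 - z))⁻¹)
    = (Complex.Gamma ∘ fun z : ℂ => 1 - z)⁻¹ from rfl, h4]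
  ring

lemma inv_Gamma_one_sub_mul_inv_Gamma_one_add {z : ℂ} (hz : z ≠ 0) :
    (Complex.Gamma (1 - z))⁻¹ * (Complex.Gamma (1 + z))⁻¹
      = Complex.sin (Real.pi * z) / (Real.pi * z) := by
  have h := Complex.Gamma_mul_Gamma_one_sub z
  rw [add_comm 1 z, Complex.Gamma_add_one z hz, ← mul_inv]
  calc (Complex.Gamma (1 - z) * (z * Complex.Gamma z))⁻¹
      = (z * (Complex.Gamma z * Complex.Gamma (1 - z)))⁻¹ := by ring_nf
    _ = _ := by rw [h, mul_inv, inv_div]; field_simp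

/-- The second order expansion of the reciprocal Gamma function at `1`. -/
lemma exists_inv_Gamma_one_sub_expansion :
    ∃ g : ℂ → ℂ, Continuous g ∧ ∀ z : ℂ, (Complex.Gamma (1 - z))⁻¹
      = 1 - eulerGamma * z + ((eulerGamma : ℂ) ^ 2 - (Real.pi : ℂ) ^ 2 / 6) / 2 * z ^ 2
        + z ^ 3 * g z := by
  have hf : Differentiable ℂ (fun z : ℂ => (Complex.Gamma (1 - z))⁻¹) :=
    Complex.differentiable_one_div_Gamma.comp (differentiable_id.const_sub 1)
  obtain ⟨g₁, hg₁, e₁, d₁⟩ := exists_entire_quotient hf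
  obtain ⟨g₂, hg₂, e₂, -⟩ := exists_entire_quotient hg₁
  obtain ⟨g₃, hg₃, e₃, -⟩ := exists_entire_quotient hg₂
  rw [deriv_inv_Gamma_one_sub_zero] at d₁
  simp only [sub_zero, Complex.Gamma_one, inv_one] at e₁
  have hc₁ := hg₁.continuous
  have hc₂ := hg₂.continuous
  set h : ℂ → ℂ := fun z => g₂ z + g₂ (-z) - g₁ z * g₁ (-z) + (Real.pi : ℂ) ^ 2 / 6 with hh
  have hcont : Continuous h := by fun_prop
  have hbound : ∀ z : ℂ, z ≠ 0 → ‖(Real.pi : ℂ) * z‖ ≤ 1 →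
      ‖h z‖ ≤ Real.pi ^ 4 / 100 * ‖z‖ ^ 2 := by
    intro z hz hz1
    have hpi : (Real.pi : ℂ) ≠ 0 := by exact_mod_cast Real.pi_ne_zero
    have hs := Complex.sin_bound hz1
    have hr := inv_Gamma_one_sub_mul_inv_Gamma_one_add hz
    have e₁' := e₁ (-z)
    rw [sub_neg_eq_add] at e₁'
    rw [e₁ z, e₁'] at hr
    have key : (Real.pi * z ^ 3) * h z = Complex.sin (Real.pi * z)
        - (Real.pi * z - (Real.pi * z) ^ 3 / 6) := by
      have hsin : Complex.sin (Real.pi * z)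
          = (1 + z * g₁ z) * (1 + -z * g₁ (-z)) * (Real.pi * z) := by
        rw [hr]; field_simp
      rw [hsin, hh]
      have a1 := e₂ z
      have a2 := e₂ (-z)
      have a3 : z * g₁ z - z * g₁ (-z) = z ^ 2 * (g₂ z + g₂ (-z)) := by
        rw [a1, a2]; ring
      linear_combination (-(Real.pi : ℂ) * z) * a3
    rw [← key] at hs
    simp only [norm_mul, norm_pow, Complex.norm_real, Real.norm_eq_abs,
      abs_of_pos Real.pi_pos] at hs
    have hzp : 0 < ‖z‖ := norm_pos_iff.2 hz
    have hp : 0 < Real.pi * ‖z‖ ^ 3 := by have := Real.pi_pos; positivity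
    refine le_of_mul_le_mul_left (hs.trans (le_of_eq ?_)) hp
    ring
  have h0 : h 0 = 0 := by
    have t1 : Filter.Tendsto h (nhdsWithin 0 {0}ᶜ) (nhds (h 0)) :=
      hcont.continuousAt.tendsto.mono_left nhdsWithin_le_nhds
    refine tendsto_nhds_unique t1 (squeeze_zero_norm' (a := fun z => Real.pi ^ 4 / 100 * ‖z‖ ^ 2)
      ?_ ?_)
    · have t2 : ∀ᶠ z : ℂ in nhds 0, ‖(Real.pi : ℂ) * z‖ < 1 :=
        (isOpen_lt (by fun_prop) continuous_const).mem_nhds (by simp)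
      filter_upwards [nhdsWithin_le_nhds t2, self_mem_nhdsWithin] with z hz1 hz0
      exact hbound z hz0 hz1.le
    · have : Continuous fun z : ℂ => Real.pi ^ 4 / 100 * ‖z‖ ^ 2 := by fun_prop
      simpa using (this.tendsto 0).mono_left nhdsWithin_le_nhds
  refine ⟨g₃, hg₃.continuous, fun z => ?_⟩
  simp only [hh, neg_zero, d₁] at h0
  rw [e₁, e₂, e₃, d₁]
  linear_combination (z ^ 2 / 2) * h0

/-- The real form of `exists_inv_Gamma_one_sub_expansion` on the unit interval. -/
lemma exists_abs_inv_Gamma_one_sub_le :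
    ∃ C : ℝ, ∀ u ∈ Set.Icc (0 : ℝ) 1, |(Real.Gamma (1 - u))⁻¹
      - (1 - eulerGamma * u + (eulerGamma ^ 2 - Real.pi ^ 2 / 6) / 2 * u ^ 2)| ≤ C * u ^ 3 := by
  obtain ⟨g, hg, e⟩ := exists_inv_Gamma_one_sub_expansion
  obtain ⟨C, hC⟩ := (isCompact_Icc (a := (0 : ℝ)) (b := 1)).exists_bound_of_continuousOn
    (hg.comp Complex.continuous_ofReal).continuousOn
  refine ⟨C, fun u hu => ?_⟩
  have h := e u
  rw [← Complex.ofReal_one, ← Complex.ofReal_sub, Complex.Gamma_ofReal] at h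
  have h' : (((Real.Gamma (1 - u))⁻¹
      - (1 - eulerGamma * u + (eulerGamma ^ 2 - Real.pi ^ 2 / 6) / 2 * u ^ 2) : ℝ) : ℂ)
      = (u : ℂ) ^ 3 * g u := by
    push_cast
    rw [h]
    push_cast
    ring
  rw [← Real.norm_eq_abs, ← Complex.norm_real, h', norm_mul, norm_pow, Complex.norm_real,
    Real.norm_eq_abs, abs_of_nonneg hu.1, mul_comm]
  exact mul_le_mul_of_nonneg_right (hC u hu) (pow_nonneg hu.1 3)

lemma continuous_real_inv_Gamma : Continuous fun s : ℝ => (Real.Gamma s)⁻¹ := by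
  have h : (fun s : ℝ => (Real.Gamma s)⁻¹) = fun s : ℝ => ((Complex.Gamma s)⁻¹).re := by
    ext s
    rw [Complex.Gamma_ofReal, ← Complex.ofReal_inv, Complex.ofReal_re]
  rw [h]
  exact Complex.continuous_re.comp
    (Complex.differentiable_one_div_Gamma.continuous.comp Complex.continuous_ofReal)

/-- The upper incomplete Gamma function. -/
noncomputable def upperGamma (s x : ℝ) : ℝ := ∫ y in Set.Ioi x, Real.exp (-y) * y ^ (s - 1)

lemma integrableOn_exp_neg_mul_rpow {x : ℝ} (hx : 0 < x) (r : ℝ) :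
    IntegrableOn (fun y : ℝ => Real.exp (-y) * y ^ r) (Set.Ioi x) := by
  refine integrable_of_isBigO_exp_neg (b := 1 / 2) (by norm_num) ?_ ?_
  · refine ContinuousOn.mul (by fun_prop) (ContinuousOn.rpow_const continuousOn_id ?_)
    intro y hy
    exact Or.inl (hx.trans_le hy).ne'
  · have h := (isLittleO_exp_neg_mul_rpow_atTop (a := 1 / 2) (by norm_num) (-r)).isBigO
    have h2 := ((isBigO_refl (fun y : ℝ => Real.exp (-(1 / 2) * y)) Filter.atTop).mul h).mul
      (isBigO_refl (fun y : ℝ => y ^ r) Filter.atTop)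
    refine h2.congr' ?_ ?_
    · filter_upwards with y
      rw [← Real.exp_add]; ring_nf
    · filter_upwards [Filter.eventually_gt_atTop 0] with y hy
      rw [mul_assoc, ← Real.rpow_add hy]; simp

lemma upperGamma_nonneg {x : ℝ} (hx : 0 < x) (s : ℝ) : 0 ≤ upperGamma s x :=
  setIntegral_nonneg measurableSet_Ioi fun _ hy =>
    mul_nonneg (Real.exp_pos _).le (Real.rpow_nonneg (hx.trans hy).le _)

lemma upperGamma_add_one {x : ℝ} (hx : 0 < x) (s : ℝ) :
    upperGamma (s + 1) x = Real.exp (-x) * x ^ s + s * upperGamma s x := by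
  have i₁ := integrableOn_exp_neg_mul_rpow hx s
  have i₂ := (integrableOn_exp_neg_mul_rpow hx (s - 1)).const_mul s
  have hd : ∀ y ∈ Set.Ici x, HasDerivAt (fun y : ℝ => -(Real.exp (-y) * y ^ s))
      (Real.exp (-y) * y ^ s - s * (Real.exp (-y) * y ^ (s - 1))) y := by
    intro y hy
    have hy0 : y ≠ 0 := (hx.trans_le hy).ne'
    have h1 : HasDerivAt (fun y : ℝ => Real.exp (-y)) (-Real.exp (-y)) y := by
      simpa using (hasDerivAt_id y).neg.exp
    have h2 := (h1.mul (Real.hasDerivAt_rpow_const (p := s) (Or.inl hy0))).neg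
    refine h2.congr_deriv ?_
    ring
  have ht : Filter.Tendsto (fun y : ℝ => -(Real.exp (-y) * y ^ s)) Filter.atTop (nhds 0) := by
    have := (tendsto_rpow_mul_exp_neg_mul_atTop_nhds_zero s 1 one_pos).neg
    simpa [mul_comm] using this
  have h := integral_Ioi_of_hasDerivAt_of_tendsto
    (hd x Set.self_mem_Ici).continuousAt.continuousWithinAt
    (fun y hy => hd y (Set.Ioi_subset_Ici_self hy)) (i₁.sub i₂) ht
  rw [integral_sub i₁ i₂, integral_const_mul] at h
  unfold upperGamma
  rw [add_sub_cancel_right]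
  linarith

lemma upperGamma_le_of_le_one {x s : ℝ} (hx : 0 < x) (hs : s ≤ 1) :
    upperGamma s x ≤ Real.exp (-x) * x ^ (s - 1) := by
  have h := upperGamma_add_one hx (s - 1)
  rw [sub_add_cancel] at h
  nlinarith [upperGamma_nonneg hx (s - 1)]

lemma abs_exp_mul_upperGamma_sub_le {x u : ℝ} (hx : 1 ≤ x) (hu : u ∈ Set.Icc (0 : ℝ) 1) :
    |Real.exp x * upperGamma (1 - u) x - x ^ (-u)| ≤ 1 / x := by
  have hx0 : 0 < x := by linarith
  have h := upperGamma_add_one hx0 (-u)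
  have h1 := upperGamma_nonneg hx0 (-u)
  have h2 := upperGamma_le_of_le_one hx0 (s := -u) (by linarith [hu.1])
  have h3 : x ^ (-u - 1) ≤ 1 / x := by
    rw [one_div, ← Real.rpow_neg_one]
    exact Real.rpow_le_rpow_of_exponent_le hx (by linarith [hu.1])
  have he : Real.exp x * Real.exp (-x) = 1 := by rw [← Real.exp_add]; simp
  have h4 : Real.exp x * upperGamma (1 - u) x - x ^ (-u)
      = -(u * (Real.exp x * upperGamma (-u) x)) := by
    rw [show 1 - u = -u + 1 by ring, h]
    linear_combination x ^ (-u) * he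
  have h5 : Real.exp x * upperGamma (-u) x ≤ 1 / x := by
    calc _ ≤ Real.exp x * (Real.exp (-x) * x ^ (-u - 1)) :=
          mul_le_mul_of_nonneg_left h2 (Real.exp_pos _).le
      _ = x ^ (-u - 1) := by rw [← mul_assoc, he, one_mul]
      _ ≤ _ := h3
  have h6 : 0 ≤ Real.exp x * upperGamma (-u) x := mul_nonneg (Real.exp_pos _).le h1
  rw [h4, abs_neg, abs_of_nonneg (mul_nonneg hu.1 h6)]
  nlinarith [hu.2]

lemma measurable_upperGamma (x : ℝ) : Measurable fun s => upperGamma s x := by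
  refine (StronglyMeasurable.integral_prod_right (ν := volume.restrict (Set.Ioi x))
    (f := fun s y : ℝ => Real.exp (-y) * y ^ (s - 1)) ?_).measurable
  exact Measurable.stronglyMeasurable (by unfold Function.uncurry; fun_prop)

/-- The regularized upper incomplete Gamma function `Γ(s, x) / Γ(s)`. -/
noncomputable def regUpperGamma (x s : ℝ) : ℝ := upperGamma s x * (Real.Gamma s)⁻¹

lemma regUpperGamma_add_one {x s : ℝ} (hx : 0 < x) (hs : 0 < s) :
    regUpperGamma x (s + 1) = Real.exp (-x) * (x ^ s / Real.Gamma (s + 1))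
      + regUpperGamma x s := by
  unfold regUpperGamma
  have := Real.Gamma_pos_of_pos hs
  rw [upperGamma_add_one hx, Real.Gamma_add_one hs.ne']
  field_simp

lemma one_sub_regUpperGamma_mem {x s : ℝ} (hx : 0 < x) (hs : 0 < s) :
    1 - regUpperGamma x s ∈ Set.Icc 0 (x ^ s / Real.Gamma (s + 1)) := by
  have hG := Real.Gamma_pos_of_pos hs
  have hi := Real.GammaIntegral_convergent hs
  have hsplit : Real.Gamma s = (∫ y in Set.Ioc 0 x, Real.exp (-y) * y ^ (s - 1))
      + upperGamma s x := by
    rw [Real.Gamma_eq_integral hs, ← Set.Ioc_union_Ioi_eq_Ioi hx.le]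
    exact setIntegral_union (Set.Ioc_disjoint_Ioi le_rfl) measurableSet_Ioi
      (hi.mono_set Set.Ioc_subset_Ioi_self) (hi.mono_set (Set.Ioi_subset_Ioi hx.le))
  have hr : ∫ y in Set.Ioc 0 x, y ^ (s - 1) = x ^ s / s := by
    rw [← intervalIntegral.integral_of_le hx.le, integral_rpow (Or.inl (by linarith))]
    simp [Real.zero_rpow hs.ne']
  have hir : IntegrableOn (fun y : ℝ => y ^ (s - 1)) (Set.Ioc 0 x) :=
    (intervalIntegrable_iff_integrableOn_Ioc_of_le hx.le).1
      (intervalIntegral.intervalIntegrable_rpow' (by linarith))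
  have hle : (∫ y in Set.Ioc 0 x, Real.exp (-y) * y ^ (s - 1)) ≤ x ^ s / s := by
    rw [← hr]
    refine setIntegral_mono_on (hi.mono_set Set.Ioc_subset_Ioi_self) hir measurableSet_Ioc ?_
    intro y hy
    exact mul_le_of_le_one_left (Real.rpow_nonneg hy.1.le _)
      (Real.exp_le_one_iff.2 (by linarith [hy.1]))
  have h0 : 0 ≤ ∫ y in Set.Ioc 0 x, Real.exp (-y) * y ^ (s - 1) :=
    setIntegral_nonneg measurableSet_Ioc fun y hy =>
      mul_nonneg (Real.exp_pos _).le (Real.rpow_nonneg hy.1.le _)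
  have heq : 1 - regUpperGamma x s
      = (∫ y in Set.Ioc 0 x, Real.exp (-y) * y ^ (s - 1)) / Real.Gamma s := by
    unfold regUpperGamma
    rw [eq_div_iff hG.ne', sub_mul, mul_assoc, inv_mul_cancel₀ hG.ne', hsplit]
    ring
  rw [heq, Real.Gamma_add_one hs.ne', ← div_div]
  exact ⟨div_nonneg h0 hG.le, div_le_div_of_nonneg_right hle hG.le⟩

lemma abs_regUpperGamma_le_one {x s : ℝ} (hx : 0 < x) (hs : 0 < s) :
    |regUpperGamma x s| ≤ 1 := by
  unfold regUpperGamma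
  rw [abs_of_nonneg (mul_nonneg (upperGamma_nonneg hx s)
    (inv_nonneg.2 (Real.Gamma_pos_of_pos hs).le))]
  have h := (one_sub_regUpperGamma_mem hx hs).1
  unfold regUpperGamma at h
  linarith

lemma intervalIntegrable_regUpperGamma {x a b : ℝ} (hx : 0 < x) (ha : 0 ≤ a) (hb : 0 ≤ b) :
    IntervalIntegrable (regUpperGamma x) volume a b := by
  have hm : Measurable (regUpperGamma x) :=
    (measurable_upperGamma x).mul continuous_real_inv_Gamma.measurable
  refine (intervalIntegrable_const (c := (1 : ℝ))).mono_fun hm.aestronglyMeasurable ?_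
  refine (ae_restrict_mem measurableSet_uIoc).mono fun s hs => ?_
  have hs0 : 0 < s := (le_min ha hb).trans_lt hs.1
  simpa using abs_regUpperGamma_le_one hx hs0

lemma intervalIntegral_rpow_div_Gamma {x : ℝ} (hx : 0 < x) (n : ℕ) :
    ∫ s in (0 : ℝ)..n, x ^ s / Real.Gamma (s + 1)
      = Real.exp x * ((∫ s in (n : ℝ)..n + 1, regUpperGamma x s)
        - ∫ s in (0 : ℝ)..1, regUpperGamma x s) := by
  have hn : (0 : ℝ) ≤ n := n.cast_nonneg
  have he : Real.exp x * Real.exp (-x) = 1 := by rw [← Real.exp_add]; simp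
  have h1 : ∫ s in (0 : ℝ)..n, x ^ s / Real.Gamma (s + 1)
      = ∫ s in (0 : ℝ)..n, Real.exp x * (regUpperGamma x (s + 1) - regUpperGamma x s) := by
    refine intervalIntegral.integral_congr_ae (Filter.Eventually.of_forall fun s hs => ?_)
    rw [Set.uIoc_of_le hn] at hs
    rw [regUpperGamma_add_one hx hs.1, add_sub_cancel_right, ← mul_assoc, he, one_mul]
  have i1 : IntervalIntegrable (fun s => regUpperGamma x (s + 1)) volume 0 n := by
    have := (intervalIntegrable_regUpperGamma hx (a := 1) (b := n + 1) zero_le_one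
      (by linarith)).comp_add_right 1
    simpa using this
  rw [h1, intervalIntegral.integral_const_mul, intervalIntegral.integral_sub i1
    (intervalIntegrable_regUpperGamma hx le_rfl hn),
    intervalIntegral.integral_comp_add_right (regUpperGamma x), zero_add,
    intervalIntegral.integral_interval_sub_interval_comm'
      (intervalIntegrable_regUpperGamma hx zero_le_one (by linarith))
      (intervalIntegrable_regUpperGamma hx le_rfl hn)
      (intervalIntegrable_regUpperGamma hx zero_le_one le_rfl)]

lemma tendsto_intervalIntegral_regUpperGamma {x : ℝ} (hx : 1 ≤ x) :
    Filter.Tendsto (fun n : ℕ => ∫ s in (n : ℝ)..n + 1, regUpperGamma x s) Filter.atTop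
      (nhds 1) := by
  have hx0 : 0 < x := by linarith
  have hz : Filter.Tendsto (fun n : ℕ => x * (x ^ n / n.factorial)) Filter.atTop (nhds 0) := by
    simpa using (FloorSemiring.tendsto_pow_div_factorial_atTop x).const_mul x
  rw [tendsto_iff_norm_sub_tendsto_zero]
  refine squeeze_zero' (Filter.Eventually.of_forall fun _ => norm_nonneg _) ?_ hz
  filter_upwards [Filter.eventually_ge_atTop 1] with n hn
  have hn1 : (1 : ℝ) ≤ n := by exact_mod_cast hn
  have h1 : (∫ s in (n : ℝ)..n + 1, regUpperGamma x s) - 1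
      = ∫ s in (n : ℝ)..n + 1, (regUpperGamma x s - 1) := by
    rw [intervalIntegral.integral_sub (intervalIntegrable_regUpperGamma hx0 (by linarith)
      (by linarith)) intervalIntegrable_const]
    simp
  rw [h1]
  have := intervalIntegral.norm_integral_le_of_norm_le_const (a := (n : ℝ)) (b := n + 1)
    (f := fun s => regUpperGamma x s - 1) (C := x * (x ^ n / n.factorial)) ?_
  · simpa using this
  intro s hs
  rw [Set.uIoc_of_le (by linarith)] at hs
  have hs0 : 0 < s := by linarith [hs.1]
  have hm := one_sub_regUpperGamma_mem hx0 hs0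
  rw [Real.norm_eq_abs, abs_sub_comm, abs_of_nonneg hm.1]
  refine hm.2.trans ?_
  have hG : (n.factorial : ℝ) ≤ Real.Gamma (s + 1) := by
    rw [← Real.Gamma_nat_eq_factorial]
    exact Real.Gamma_strictMonoOn_Ici.monotoneOn (by simp; linarith)
      (by simp; linarith [hs.1]) (by linarith [hs.1])
  have hp : x ^ s ≤ x * x ^ n := by
    rw [← pow_succ', ← Real.rpow_natCast]
    exact Real.rpow_le_rpow_of_exponent_le hx (by push_cast; exact hs.2)
  rw [← mul_div_assoc]
  exact div_le_div₀ (by positivity) hp (by positivity) hG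

/-- The Volterra function in terms of the regularized incomplete Gamma function. -/
lemma volterra_eq_exp_sub {x : ℝ} (hx : 1 ≤ x) :
    volterra x = Real.exp x - Real.exp x * ∫ s in (0 : ℝ)..1, regUpperGamma x s := by
  have hx0 : 0 < x := by linarith
  have hlim : Filter.Tendsto (fun n : ℕ => ∫ s in (0 : ℝ)..n, x ^ s / Real.Gamma (s + 1))
      Filter.atTop (nhds (Real.exp x * (1 - ∫ s in (0 : ℝ)..1, regUpperGamma x s))) := by
    simp_rw [intervalIntegral_rpow_div_Gamma hx0]
    exact ((tendsto_intervalIntegral_regUpperGamma hx).sub_const _).const_mul _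
  have hcont : Continuous fun s : ℝ => x ^ s / Real.Gamma (s + 1) := by
    simp_rw [div_eq_mul_inv]
    exact (Real.continuous_const_rpow hx0.ne').mul
      (continuous_real_inv_Gamma.comp (continuous_add_const 1))
  have hint : IntegrableOn (fun s : ℝ => x ^ s / Real.Gamma (s + 1)) (Set.Ioi 0) := by
    refine integrableOn_Ioi_of_intervalIntegral_norm_tendsto _ 0
      (fun n : ℕ => hcont.integrableOn_Ioc) tendsto_natCast_atTop_atTop
      (hlim.congr fun n => ?_)
    refine intervalIntegral.integral_congr fun s hs => ?_
    rw [Set.uIcc_of_le n.cast_nonneg] at hs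
    have := Real.Gamma_pos_of_pos (s := s + 1) (by linarith [hs.1])
    exact (Real.norm_of_nonneg (by positivity)).symm
  have h := tendsto_nhds_unique
    (intervalIntegral_tendsto_integral_Ioi 0 hint tendsto_natCast_atTop_atTop) hlim
  unfold volterra
  rw [h]; ring

lemma integral_pow_mul_exp_neg_mul {L : ℝ} (hL : 0 < L) (k : ℕ) :
    ∫ u in Set.Ioi (0 : ℝ), u ^ k * Real.exp (-(L * u)) = k.factorial / L ^ (k + 1) := by
  have h := Real.integral_rpow_mul_exp_neg_mul_Ioi (a := k + 1) (by positivity) hL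
  simp only [add_sub_cancel_right, Real.rpow_natCast, Real.Gamma_nat_eq_factorial] at h
  rw [h, ← Nat.cast_succ, Real.rpow_natCast, one_div, inv_pow]
  field_simp

lemma integrableOn_pow_mul_exp_neg_mul {L : ℝ} (hL : 0 < L) (k : ℕ) :
    IntegrableOn (fun u : ℝ => u ^ k * Real.exp (-(L * u))) (Set.Ioi 0) := by
  refine Integrable.of_integral_ne_zero ?_
  rw [integral_pow_mul_exp_neg_mul hL]
  positivity

lemma abs_intervalIntegral_quadratic_mul_exp_sub_le {L : ℝ} (hL : 0 < L) (a b : ℝ) :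
    |(∫ u in (0 : ℝ)..1, (1 + a * u + b * u ^ 2) * Real.exp (-(L * u)))
      - (1 / L + a / L ^ 2 + 2 * b / L ^ 3)| ≤ (1 + |a| + |b|) * (6 / L ^ 4) := by
  have i := integrableOn_pow_mul_exp_neg_mul hL
  have e := integral_pow_mul_exp_neg_mul hL
  have hf : (fun u : ℝ => (1 + a * u + b * u ^ 2) * Real.exp (-(L * u)))
      = fun u => (u ^ 0 * Real.exp (-(L * u)) + a * (u ^ 1 * Real.exp (-(L * u))))
        + b * (u ^ 2 * Real.exp (-(L * u))) := by
    ext u; ring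
  have i0 : IntegrableOn (fun u : ℝ => (1 + a * u + b * u ^ 2) * Real.exp (-(L * u)))
      (Set.Ioi 0) := by
    rw [hf]
    exact ((i 0).add ((i 1).const_mul a)).add ((i 2).const_mul b)
  have hI : ∫ u in Set.Ioi (0 : ℝ), (1 + a * u + b * u ^ 2) * Real.exp (-(L * u))
      = 1 / L + a / L ^ 2 + 2 * b / L ^ 3 := by
    have i01 : IntegrableOn (fun u : ℝ => u ^ 0 * Real.exp (-(L * u))
        + a * (u ^ 1 * Real.exp (-(L * u)))) (Set.Ioi 0) := (i 0).add ((i 1).const_mul a)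
    rw [hf, integral_add i01 ((i 2).const_mul b),
      integral_add (i 0) ((i 1).const_mul a), integral_const_mul, integral_const_mul, e, e, e]
    simp only [Nat.factorial]
    push_cast
    ring
  have hsplit : ∫ u in Set.Ioi (0 : ℝ), (1 + a * u + b * u ^ 2) * Real.exp (-(L * u))
      = (∫ u in (0 : ℝ)..1, (1 + a * u + b * u ^ 2) * Real.exp (-(L * u)))
        + ∫ u in Set.Ioi (1 : ℝ), (1 + a * u + b * u ^ 2) * Real.exp (-(L * u)) := by
    rw [intervalIntegral.integral_of_le zero_le_one, ← Set.Ioc_union_Ioi_eq_Ioi zero_le_one]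
    exact setIntegral_union (Set.Ioc_disjoint_Ioi le_rfl) measurableSet_Ioi
      (i0.mono_set Set.Ioc_subset_Ioi_self) (i0.mono_set (Set.Ioi_subset_Ioi zero_le_one))
  have htail : |∫ u in Set.Ioi (1 : ℝ), (1 + a * u + b * u ^ 2) * Real.exp (-(L * u))|
      ≤ ∫ u in Set.Ioi (1 : ℝ), (1 + |a| + |b|) * (u ^ 3 * Real.exp (-(L * u))) := by
    rw [← Real.norm_eq_abs]
    refine norm_integral_le_of_norm_le (Integrable.const_mul
      ((i 3).mono_set (Set.Ioi_subset_Ioi zero_le_one)) _) ?_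
    refine (ae_restrict_mem measurableSet_Ioi).mono fun u hu => ?_
    have hu1 : 1 ≤ u := le_of_lt hu
    have h2 : u ≤ u ^ 3 := le_self_pow₀ hu1 (by norm_num)
    have h3 : u ^ 2 ≤ u ^ 3 := pow_le_pow_right₀ hu1 (by norm_num)
    rw [norm_mul, Real.norm_of_nonneg (Real.exp_pos _).le, ← mul_assoc]
    refine mul_le_mul_of_nonneg_right ?_ (Real.exp_pos _).le
    calc ‖1 + a * u + b * u ^ 2‖ ≤ ‖(1 : ℝ)‖ + ‖a * u‖ + ‖b * u ^ 2‖ := norm_add₃_le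
      _ = 1 + |a| * u + |b| * u ^ 2 := by
        simp [Real.norm_eq_abs, abs_of_nonneg (zero_le_one.trans hu1)]
      _ ≤ 1 * u ^ 3 + |a| * u ^ 3 + |b| * u ^ 3 := by gcongr; linarith
      _ = _ := by ring
  have htail2 : ∫ u in Set.Ioi (1 : ℝ), (1 + |a| + |b|) * (u ^ 3 * Real.exp (-(L * u)))
      ≤ (1 + |a| + |b|) * (6 / L ^ 4) := by
    have h6 : (6 : ℝ) / L ^ 4 = ∫ u in Set.Ioi (0 : ℝ), u ^ 3 * Real.exp (-(L * u)) := by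
      rw [e]; norm_num [Nat.factorial]
    rw [h6, ← integral_const_mul]
    refine setIntegral_mono_set ((i 3).const_mul _) ?_
      (Set.Ioi_subset_Ioi zero_le_one).eventuallyLE
    refine (ae_restrict_mem measurableSet_Ioi).mono fun u hu => ?_
    have hu0 : 0 < u := hu
    simp only [Pi.zero_apply]
    positivity
  rw [← hI, hsplit, abs_sub_comm, add_sub_cancel_left]
  exact htail.trans htail2

/-- As `x → ∞`,
`ν(x) = e^x − 1/log x + γ_EM/(log x)² − (γ_EM² − π²/6)/(log x)³ + O(1/(log x)⁴)`. -/
theorem volterra_asymptotics_infinity :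
    (fun x : ℝ => volterra x - Real.exp x + 1 / Real.log x - eulerGamma / (Real.log x) ^ 2
        + (eulerGamma ^ 2 - Real.pi ^ 2 / 6) / (Real.log x) ^ 3)
      =O[Filter.atTop] (fun x : ℝ => 1 / (Real.log x) ^ 4) := by
  obtain ⟨C, hC⟩ := exists_abs_inv_Gamma_one_sub_le
  have hφ : Continuous fun u : ℝ => (Real.Gamma (1 - u))⁻¹ :=
    continuous_real_inv_Gamma.comp (by fun_prop)
  obtain ⟨M, hM⟩ := (isCompact_Icc (a := (0 : ℝ)) (b := 1)).exists_bound_of_continuousOn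
    hφ.continuousOn
  have hM0 : 0 ≤ M := (norm_nonneg _).trans (hM 0 (by simp))
  have hC0 : 0 ≤ C := by simpa using (abs_nonneg _).trans (hC 1 (by simp))
  set a := -eulerGamma with ha
  set b := (eulerGamma ^ 2 - Real.pi ^ 2 / 6) / 2 with hb
  have hx_le : ∀ᶠ x : ℝ in Filter.atTop, Real.log x ^ 4 ≤ x := by
    filter_upwards [(Real.isLittleO_pow_log_id_atTop (n := 4)).bound one_pos,
      Filter.eventually_ge_atTop 0] with x h hx
    simpa [abs_of_nonneg hx] using (le_abs_self _).trans h
  refine IsBigO.of_bound (M + 6 * C + 6 * (1 + |a| + |b|)) ?_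
  filter_upwards [hx_le, Filter.eventually_gt_atTop 1] with x hxL hx
  have hx0 : 0 < x := by linarith
  have hL : 0 < Real.log x := Real.log_pos hx
  set L := Real.log x with hLdef
  have hsub : Real.exp x * ∫ s in (0 : ℝ)..1, regUpperGamma x s
      = ∫ u in (0 : ℝ)..1, Real.exp x * regUpperGamma x (1 - u) := by
    rw [intervalIntegral.integral_const_mul, intervalIntegral.integral_comp_sub_left]
    simp
  have i1 : IntervalIntegrable (fun u => Real.exp x * regUpperGamma x (1 - u)) volume 0 1 := by
    have := (intervalIntegrable_regUpperGamma hx0 (a := 1) (b := 0) zero_le_one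
      le_rfl).comp_sub_left 1
    simpa using this.const_mul (Real.exp x)
  have i2 : IntervalIntegrable (fun u : ℝ => (1 + a * u + b * u ^ 2) * Real.exp (-(L * u)))
      volume 0 1 := Continuous.intervalIntegrable (by fun_prop) _ _
  have i3 := integrableOn_pow_mul_exp_neg_mul hL 3
  have i3' : IntervalIntegrable (fun u : ℝ => u ^ 3 * Real.exp (-(L * u))) volume 0 1 :=
    Continuous.intervalIntegrable (by fun_prop) _ _
  have hdiff : |(∫ u in (0 : ℝ)..1, Real.exp x * regUpperGamma x (1 - u))
      - ∫ u in (0 : ℝ)..1, (1 + a * u + b * u ^ 2) * Real.exp (-(L * u))|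
      ≤ M / x + C * (6 / L ^ 4) := by
    rw [← intervalIntegral.integral_sub i1 i2]
    have hb1 : ∀ u ∈ Set.Ioc (0 : ℝ) 1, ‖Real.exp x * regUpperGamma x (1 - u)
        - (1 + a * u + b * u ^ 2) * Real.exp (-(L * u))‖
        ≤ M / x + C * (u ^ 3 * Real.exp (-(L * u))) := by
      intro u hu
      have hu' := Set.Ioc_subset_Icc_self hu
      have hxu : x ^ (-u) = Real.exp (-(L * u)) := by
        rw [Real.rpow_def_of_pos hx0, mul_neg]
      have h1 := abs_exp_mul_upperGamma_sub_le hx.le hu'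
      rw [hxu] at h1
      have hsplit : Real.exp x * regUpperGamma x (1 - u)
          - (1 + a * u + b * u ^ 2) * Real.exp (-(L * u))
          = (Real.Gamma (1 - u))⁻¹
              * (Real.exp x * upperGamma (1 - u) x - Real.exp (-(L * u)))
            + ((Real.Gamma (1 - u))⁻¹ - (1 - eulerGamma * u + b * u ^ 2))
              * Real.exp (-(L * u)) := by
        rw [regUpperGamma, ha]; ring
      rw [hsplit]
      refine (norm_add_le _ _).trans (add_le_add ?_ ?_)
      · rw [norm_mul, div_eq_mul_one_div]
        exact mul_le_mul (hM u hu') h1 (norm_nonneg _) hM0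
      · rw [norm_mul, Real.norm_of_nonneg (Real.exp_pos _).le, ← mul_assoc]
        exact mul_le_mul_of_nonneg_right (hC u hu') (Real.exp_pos _).le
    have h2 := intervalIntegral.norm_integral_le_of_norm_le zero_le_one
      (Filter.Eventually.of_forall hb1) (intervalIntegrable_const.add (i3'.const_mul C))
    refine h2.trans ?_
    rw [intervalIntegral.integral_add intervalIntegrable_const (i3'.const_mul C),
      intervalIntegral.integral_const_mul]
    have h6 : ∫ u in (0 : ℝ)..1, u ^ 3 * Real.exp (-(L * u)) ≤ 6 / L ^ 4 := by
      have e : (6 : ℝ) / L ^ 4 = ∫ u in Set.Ioi (0 : ℝ), u ^ 3 * Real.exp (-(L * u)) := by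
        rw [integral_pow_mul_exp_neg_mul hL]; norm_num [Nat.factorial]
      rw [e, intervalIntegral.integral_of_le zero_le_one]
      refine setIntegral_mono_set i3 ?_ Set.Ioc_subset_Ioi_self.eventuallyLE
      refine (ae_restrict_mem measurableSet_Ioi).mono fun u hu => ?_
      have hu0 : 0 < u := hu
      simp only [Pi.zero_apply]
      positivity
    have := mul_le_mul_of_nonneg_left h6 hC0
    simpa using this
  have hquad := abs_intervalIntegral_quadratic_mul_exp_sub_le hL a b
  have hfinal : volterra x - Real.exp x + 1 / L - eulerGamma / L ^ 2
      + (eulerGamma ^ 2 - Real.pi ^ 2 / 6) / L ^ 3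
      = -(((∫ u in (0 : ℝ)..1, Real.exp x * regUpperGamma x (1 - u))
        - ∫ u in (0 : ℝ)..1, (1 + a * u + b * u ^ 2) * Real.exp (-(L * u)))
        + ((∫ u in (0 : ℝ)..1, (1 + a * u + b * u ^ 2) * Real.exp (-(L * u)))
          - (1 / L + a / L ^ 2 + 2 * b / L ^ 3))) := by
    rw [volterra_eq_exp_sub hx.le, hsub, ha, hb]
    ring
  have hMx : M / x ≤ M * (1 / L ^ 4) := by
    rw [mul_one_div]
    exact div_le_div_of_nonneg_left hM0 (by positivity) hxL
  rw [hfinal, norm_neg, Real.norm_of_nonneg (show 0 ≤ 1 / L ^ 4 by positivity)]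
  refine (norm_add_le _ _).trans ((add_le_add hdiff hquad).trans ?_)
  calc _ ≤ (M * (1 / L ^ 4) + C * (6 / L ^ 4)) + (1 + |a| + |b|) * (6 / L ^ 4) := by gcongr
    _ = _ := by ring
end

section
/- For all real x > 0 and λ > 0, one has λ · ∫₀^x log(x−y) · ν′(λ y) dy = −1 − (log λ + γ_EM) · ν(λ x). -/
open MeasureTheory Real

/-- The derivative of the Volterra function: `ν′(x) = ∫₀^∞ s x^{s−1} / Γ(s+1) ds` for `x > 0`. -/
noncomputable def volterraDeriv (x : ℝ) : ℝ :=
  ∫ s in Set.Ioi (0 : ℝ), s * x ^ (s - 1) / Real.Gamma (s + 1)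

open Set Filter Topology

lemma integral_rpow_mul_sub_rpow {x s t : ℝ} (hx : 0 < x) (hs : 0 < s) (ht : 0 < t) :
    ∫ y in Ioo 0 x, y ^ (s - 1) * (x - y) ^ (t - 1) =
      x ^ (s + t - 1) * (Gamma s * Gamma t / Gamma (s + t)) := by
  have h := Complex.betaIntegral_scaled s t hx
  rw [Complex.betaIntegral_eq_Gamma_mul_div _ _ (by simpa) (by simpa),
    intervalIntegral.integral_of_le hx.le, integral_Ioc_eq_integral_Ioo] at h
  rw [← Complex.ofReal_inj, ← integral_complex_ofReal]
  push_cast [Complex.ofReal_cpow hx.le, ← Complex.Gamma_ofReal] at h ⊢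
  rw [← h]
  refine setIntegral_congr_fun measurableSet_Ioo fun y hy => ?_
  rw [Complex.ofReal_cpow hy.1.le, Complex.ofReal_cpow (sub_pos.2 hy.2).le]
  push_cast
  rfl

lemma integrableOn_rpow_mul_sub_rpow {x s t : ℝ} (hx : 0 < x) (hs : 0 < s) (ht : 0 < t) :
    IntegrableOn (fun y => y ^ (s - 1) * (x - y) ^ (t - 1)) (Ioo 0 x) := by
  refine not_imp_comm.1 integral_undef ?_
  rw [integral_rpow_mul_sub_rpow hx hs ht]
  have := Gamma_pos_of_pos hs
  have := Gamma_pos_of_pos ht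
  have := Gamma_pos_of_pos (add_pos hs ht)
  positivity

lemma rpow_mul_exp_neg_le_Gamma {A s : ℝ} (hA : 0 < A) (hs : 0 ≤ s) :
    A ^ s * exp (-A) ≤ Gamma (s + 1) := by
  have hint := GammaIntegral_convergent (s := s + 1) (by linarith)
  rw [Gamma_eq_integral (by linarith), ← integral_exp_neg_Ioi, ← integral_const_mul]
  calc ∫ t in Ioi A, A ^ s * exp (-t) ≤ ∫ t in Ioi A, exp (-t) * t ^ (s + 1 - 1) := by
        refine setIntegral_mono_on ((integrableOn_exp_neg_Ioi A).const_mul _)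
          (hint.mono_set (Ioi_subset_Ioi hA.le)) measurableSet_Ioi fun t ht => ?_
        rw [add_sub_cancel_right, mul_comm]
        gcongr
        exact (mem_Ioi.1 ht).le
    _ ≤ _ := by
        refine setIntegral_mono_set hint ?_ (Ioi_subset_Ioi hA.le).eventuallyLE
        filter_upwards [ae_restrict_mem measurableSet_Ioi] with t ht
        have : 0 < t := ht
        simp only [Pi.zero_apply]
        positivity

lemma differentiableAt_Gamma_of_pos {s : ℝ} (hs : 0 < s) : DifferentiableAt ℝ Gamma s :=
  differentiableAt_Gamma fun m => by linarith [m.cast_nonneg (α := ℝ)]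

lemma continuousOn_rpow_div_Gamma {X : ℝ} (hX : 0 < X) :
    ContinuousOn (fun s => X ^ s / Gamma (s + 1)) (Ioi (-1)) := by
  intro s hs
  have hs' : 0 < s + 1 := by linarith [mem_Ioi.1 hs]
  have hG : ContinuousAt (fun s => Gamma (s + 1)) s :=
    ContinuousAt.comp (f := fun s : ℝ => s + 1)
      (differentiableAt_Gamma_of_pos hs').continuousAt (by fun_prop)
  exact ((continuousAt_const_rpow hX.ne').div hG (Gamma_pos_of_pos hs').ne').continuousWithinAt

lemma integrableOn_rpow_div_Gamma {X a : ℝ} (hX : 0 < X) (ha : -1 < a) :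
    IntegrableOn (fun s => X ^ s / Gamma (s + 1)) (Ioi a) := by
  have hcont := continuousOn_rpow_div_Gamma hX
  have hloc : IntegrableOn (fun s => X ^ s / Gamma (s + 1)) (Icc a (max a 0)) :=
    (hcont.mono fun s hs => ha.trans_le hs.1).integrableOn_Icc
  have htail : IntegrableOn (fun s => X ^ s / Gamma (s + 1)) (Ioi 0) := by
    have hdom : IntegrableOn (fun s => exp (2 * X) * exp (-log 2 * s)) (Ioi 0) :=
      (integrableOn_exp_mul_Ioi (by linarith [log_pos one_lt_two]) 0).const_mul _
    refine Integrable.mono' hdom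
      ((hcont.mono (Ioi_subset_Ioi (by norm_num))).aestronglyMeasurable measurableSet_Ioi) ?_
    filter_upwards [ae_restrict_mem measurableSet_Ioi] with s hs
    have hs' : 0 < s := hs
    have hG := Gamma_pos_of_pos (show 0 < s + 1 by linarith)
    rw [norm_of_nonneg (by positivity), div_le_iff₀ hG]
    have h := rpow_mul_exp_neg_le_Gamma (A := 2 * X) (by positivity) hs'.le
    calc X ^ s = exp (2 * X) * exp (-log 2 * s) * ((2 * X) ^ s * exp (-(2 * X))) := by
          rw [mul_rpow (by norm_num) hX.le, rpow_def_of_pos (by norm_num : (0 : ℝ) < 2), neg_mul,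
            exp_neg, exp_neg]
          field_simp
      _ ≤ _ := by gcongr
  refine (hloc.union htail).mono_set fun s hs => ?_
  rcases le_or_gt s (max a 0) with h | h
  · exact Or.inl ⟨(mem_Ioi.1 hs).le, h⟩
  · exact Or.inr ((le_max_right a 0).trans_lt h)

lemma measurePreserving_add_right_restrict_Ioi (a : ℝ) :
    MeasurePreserving (fun s => s + a) (volume.restrict (Ioi 0)) (volume.restrict (Ioi a)) := by
  have h := (measurePreserving_add_right (volume : Measure ℝ) a).restrict_preimage
    (measurableSet_Ioi (a := a))
  simpa using h

lemma rpow_mul_volterraKernel_eq {x lam a s y : ℝ} (hlam : 0 < lam) (hs : 0 < s)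
    (hy : y ∈ Ioo 0 x) :
    (x - y) ^ a * (s * (lam * y) ^ (s - 1) / Gamma (s + 1)) =
      lam ^ (s - 1) / Gamma s * (y ^ (s - 1) * (x - y) ^ (a + 1 - 1)) := by
  have := (Gamma_pos_of_pos hs).ne'
  rw [Gamma_add_one hs.ne', mul_rpow hlam.le hy.1.le, add_sub_cancel_right]
  field_simp

lemma integral_rpow_mul_volterraKernel {x lam a s : ℝ} (hx : 0 < x) (hlam : 0 < lam)
    (ha : -1 < a) (hs : 0 < s) :
    ∫ y in Ioo 0 x, (x - y) ^ a * (s * (lam * y) ^ (s - 1) / Gamma (s + 1)) =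
      lam⁻¹ * (Gamma (a + 1) * lam ^ (-a)) * ((lam * x) ^ (s + a) / Gamma (s + a + 1)) := by
  rw [setIntegral_congr_fun measurableSet_Ioo
    fun y hy => rpow_mul_volterraKernel_eq hlam hs hy, integral_const_mul,
    integral_rpow_mul_sub_rpow hx hs (by linarith), mul_rpow hlam.le hx.le, rpow_sub_one hlam.ne',
    rpow_add hlam, rpow_neg hlam.le, show s + (a + 1) - 1 = s + a by ring, ← add_assoc]
  have := (Gamma_pos_of_pos hs).ne'
  have := (rpow_pos_of_pos hlam a).ne'
  field_simp

lemma integrable_rpow_mul_volterraKernel {x lam a : ℝ} (hx : 0 < x) (hlam : 0 < lam)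
    (ha : -1 < a) :
    Integrable (Function.uncurry fun y s : ℝ =>
        (x - y) ^ a * (s * (lam * y) ^ (s - 1) / Gamma (s + 1)))
      ((volume.restrict (Ioo 0 x)).prod (volume.restrict (Ioi 0))) := by
  have hmeas : AEStronglyMeasurable (Function.uncurry fun y s : ℝ =>
        (x - y) ^ a * (s * (lam * y) ^ (s - 1) / Gamma (s + 1)))
      ((volume.restrict (Ioo 0 x)).prod (volume.restrict (Ioi 0))) := by
    rw [Measure.prod_restrict]
    refine ContinuousOn.aestronglyMeasurable ?_ (measurableSet_Ioo.prod measurableSet_Ioi)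
    rintro ⟨y, s⟩ ⟨hy, hs⟩
    have hs' : 0 < s := hs
    have hs1 : 0 < s + 1 := by linarith
    have hG : ContinuousAt (fun p : ℝ × ℝ => Gamma (p.2 + 1)) (y, s) :=
      ContinuousAt.comp (f := fun p : ℝ × ℝ => p.2 + 1) (x := (y, s))
        (differentiableAt_Gamma_of_pos hs1).continuousAt (by fun_prop)
    have h1 : ContinuousAt (fun p : ℝ × ℝ => (x - p.1) ^ a) (y, s) :=
      ContinuousAt.rpow_const (by fun_prop) (Or.inl (sub_pos.2 hy.2).ne')
    have h2 : ContinuousAt (fun p : ℝ × ℝ => (lam * p.1) ^ (p.2 - 1)) (y, s) :=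
      ContinuousAt.rpow (by fun_prop) (by fun_prop) (Or.inl (mul_pos hlam hy.1).ne')
    exact (h1.mul ((continuousAt_snd.mul h2).div hG
      (Gamma_pos_of_pos hs1).ne')).continuousWithinAt
  rw [integrable_prod_iff' hmeas]
  constructor
  · filter_upwards [ae_restrict_mem measurableSet_Ioi] with s hs
    refine (integrableOn_congr_fun (fun y hy => rpow_mul_volterraKernel_eq hlam hs hy)
      measurableSet_Ioo).2 ?_
    exact (integrableOn_rpow_mul_sub_rpow hx hs (by linarith)).const_mul _
  · have hg : IntegrableOn (fun s => lam⁻¹ * (Gamma (a + 1) * lam ^ (-a)) *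
        ((lam * x) ^ (s + a) / Gamma (s + a + 1))) (Ioi 0) := by
      refine Integrable.const_mul ?_ _
      exact (measurePreserving_add_right_restrict_Ioi a).integrable_comp_of_integrable
        (integrableOn_rpow_div_Gamma (mul_pos hlam hx) ha)
    refine hg.congr ?_
    filter_upwards [ae_restrict_mem measurableSet_Ioi] with s hs
    rw [← integral_rpow_mul_volterraKernel hx hlam ha hs]
    refine setIntegral_congr_fun measurableSet_Ioo fun y hy => ?_
    have hs' : 0 < s := hs
    have := Gamma_pos_of_pos (show 0 < s + 1 by linarith)
    have := sub_pos.2 hy.2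
    have := hy.1
    exact (norm_of_nonneg (by positivity)).symm

lemma integrableOn_rpow_mul_volterraDeriv {x lam a : ℝ} (hx : 0 < x) (hlam : 0 < lam)
    (ha : -1 < a) :
    IntegrableOn (fun y => (x - y) ^ a * volterraDeriv (lam * y)) (Ioo 0 x) := by
  simpa only [Function.uncurry, integral_const_mul, volterraDeriv, IntegrableOn] using
    (integrable_rpow_mul_volterraKernel hx hlam ha).integral_prod_left

lemma integral_rpow_mul_volterraDeriv {x lam a : ℝ} (hx : 0 < x) (hlam : 0 < lam) (ha : -1 < a) :
    ∫ y in Ioo 0 x, (x - y) ^ a * volterraDeriv (lam * y) =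
      lam⁻¹ * (Gamma (a + 1) * lam ^ (-a) *
        ∫ s in Ioi a, (lam * x) ^ s / Gamma (s + 1)) := by
  have h := integral_integral_swap (integrable_rpow_mul_volterraKernel hx hlam ha)
  simp only [integral_const_mul] at h
  refine h.trans ?_
  rw [setIntegral_congr_fun measurableSet_Ioi
    fun s hs => integral_rpow_mul_volterraKernel hx hlam ha hs, integral_const_mul, mul_assoc]
  congr 2
  exact (measurePreserving_add_right_restrict_Ioi a).integral_comp
    (measurableEmbedding_addRight a) (fun s => (lam * x) ^ s / Gamma (s + 1))

lemma rpow_le_rpow_neg_add_rpow {u b c : ℝ} (hu : 0 < u) (hb : |b| ≤ c) :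
    u ^ b ≤ u ^ (-c) + u ^ c := by
  obtain ⟨h1, h2⟩ := abs_le.1 hb
  have := rpow_pos_of_pos hu c
  have := rpow_pos_of_pos hu (-c)
  rcases le_total u 1 with h | h
  · linarith [rpow_le_rpow_of_exponent_ge hu h h1]
  · linarith [rpow_le_rpow_of_exponent_le h h2]

lemma abs_log_mul_rpow_le {u a : ℝ} (hu : 0 < u) (ha : |a| ≤ 1 / 2) :
    |log u| * u ^ a ≤ 8 * (u ^ (-(3 / 4) : ℝ) + u ^ (3 / 4 : ℝ)) := by
  obtain ⟨h1, h2⟩ := abs_le.1 ha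
  have hlog : |log u| ≤ 4 * (u ^ (1 / 4 : ℝ) + u ^ (-(1 / 4) : ℝ)) := by
    have e1 := log_le_rpow_div hu.le (show (0 : ℝ) < 1 / 4 by norm_num)
    have e2 := log_le_rpow_div (inv_pos.2 hu).le (show (0 : ℝ) < 1 / 4 by norm_num)
    rw [log_inv, inv_rpow hu.le, ← rpow_neg hu.le] at e2
    have := rpow_pos_of_pos hu (1 / 4)
    have := rpow_pos_of_pos hu (-(1 / 4))
    rw [abs_le]
    constructor <;> linarith
  have e1 : u ^ (1 / 4 + a) ≤ u ^ (-(3 / 4) : ℝ) + u ^ (3 / 4 : ℝ) :=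
    rpow_le_rpow_neg_add_rpow hu (abs_le.2 ⟨by linarith, by linarith⟩)
  have e2 : u ^ (-(1 / 4) + a) ≤ u ^ (-(3 / 4) : ℝ) + u ^ (3 / 4 : ℝ) :=
    rpow_le_rpow_neg_add_rpow hu (abs_le.2 ⟨by linarith, by linarith⟩)
  rw [rpow_add hu] at e1 e2
  calc |log u| * u ^ a ≤ 4 * (u ^ (1 / 4 : ℝ) + u ^ (-(1 / 4) : ℝ)) * u ^ a := by gcongr
    _ ≤ _ := by linarith

lemma hasDerivAt_integral_rpow_mul_volterraDeriv {x lam : ℝ} (hx : 0 < x) (hlam : 0 < lam) :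
    HasDerivAt (fun a : ℝ => ∫ y in Ioo 0 x, (x - y) ^ a * volterraDeriv (lam * y))
      (∫ y in Ioo 0 x, log (x - y) * volterraDeriv (lam * y)) 0 := by
  have hmeas : AEStronglyMeasurable (fun y => volterraDeriv (lam * y))
      (volume.restrict (Ioo 0 x)) := by
    have := integrableOn_rpow_mul_volterraDeriv hx hlam (show (-1 : ℝ) < 0 by norm_num)
    simp only [rpow_zero, one_mul] at this
    exact this.aestronglyMeasurable
  have hlog : Measurable fun y : ℝ => log (x - y) := by fun_prop
  have hF' : AEStronglyMeasurable
      (fun y => (x - y) ^ (0 : ℝ) * log (x - y) * volterraDeriv (lam * y))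
      (volume.restrict (Ioo 0 x)) := by
    simp only [rpow_zero, one_mul]
    exact hlog.aestronglyMeasurable.mul hmeas
  have h := (hasDerivAt_integral_of_dominated_loc_of_deriv_le (𝕜 := ℝ)
    (s := Metric.ball 0 (1 / 2)) (x₀ := (0 : ℝ)) (μ := volume.restrict (Ioo 0 x))
    (F := fun a y => (x - y) ^ a * volterraDeriv (lam * y))
    (F' := fun a y => (x - y) ^ a * log (x - y) * volterraDeriv (lam * y))
    (bound := fun y => 8 * (‖(x - y) ^ (-(3 / 4) : ℝ) * volterraDeriv (lam * y)‖ +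
      ‖(x - y) ^ (3 / 4 : ℝ) * volterraDeriv (lam * y)‖))
    (Metric.ball_mem_nhds _ (by norm_num)) ?_
    (integrableOn_rpow_mul_volterraDeriv hx hlam (by norm_num)) hF' ?_ ?_ ?_).2
  · simpa only [rpow_zero, one_mul] using h
  · filter_upwards [lt_mem_nhds (show (-1 : ℝ) < 0 by norm_num)] with a ha
    exact (integrableOn_rpow_mul_volterraDeriv hx hlam ha).aestronglyMeasurable
  · filter_upwards [ae_restrict_mem measurableSet_Ioo] with y hy a ha
    have hu := sub_pos.2 hy.2
    have ha' : |a| ≤ 1 / 2 := by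
      rw [mem_ball_zero_iff, norm_eq_abs] at ha
      exact ha.le
    simp only [norm_mul, norm_eq_abs, abs_of_pos (rpow_pos_of_pos hu _)]
    have := mul_le_mul_of_nonneg_right (abs_log_mul_rpow_le hu ha')
      (abs_nonneg (volterraDeriv (lam * y)))
    linarith
  · exact ((integrableOn_rpow_mul_volterraDeriv hx hlam (by norm_num)).norm.add
      (integrableOn_rpow_mul_volterraDeriv hx hlam (by norm_num)).norm).const_mul 8
  · filter_upwards [ae_restrict_mem measurableSet_Ioo] with y hy a _
    exact ((hasStrictDerivAt_const_rpow (sub_pos.2 hy.2) a).hasDerivAt).mul_const _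

lemma eulerGamma_eq_eulerMascheroniConstant : eulerGamma = eulerMascheroniConstant := by
  have h : HasDerivAt Complex.GammaIntegral (-(eulerMascheroniConstant : ℂ)) 1 := by
    refine Complex.hasDerivAt_Gamma_one.congr_of_eventuallyEq ?_
    filter_upwards [(isOpen_lt continuous_const Complex.continuous_re).mem_nhds
      (show (0 : ℝ) < (1 : ℂ).re by simp)] with s hs
    exact (Complex.Gamma_eq_integral hs).symm
  have h2 := (Complex.hasDerivAt_GammaIntegral (s := 1) (by simp)).unique h
  simp only [sub_self, Complex.cpow_zero, one_mul] at h2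
  rw [eulerGamma, neg_eq_iff_eq_neg, ← Complex.ofReal_inj, ← integral_complex_ofReal]
  push_cast at h2 ⊢
  simp only [← h2, mul_comm]

lemma hasDerivAt_integral_Ioi_rpow_div_Gamma {X : ℝ} (hX : 0 < X) :
    HasDerivAt (fun a : ℝ => ∫ s in Ioi a, X ^ s / Gamma (s + 1)) (-1) 0 := by
  have hint : IntegrableOn (fun s => X ^ s / Gamma (s + 1)) (Ioi (-(1 / 2))) :=
    integrableOn_rpow_div_Gamma hX (by norm_num)
  have hc := continuousOn_rpow_div_Gamma hX
  have hd : HasDerivAt (fun a : ℝ => ∫ s in (-(1 / 2))..a, X ^ s / Gamma (s + 1))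
      (X ^ (0 : ℝ) / Gamma (0 + 1)) 0 := by
    refine intervalIntegral.integral_hasDerivAt_right ?_ ?_ ?_
    · refine (hc.mono fun s hs => ?_).intervalIntegrable
      rw [uIcc_of_le (by norm_num)] at hs
      exact lt_of_lt_of_le (by norm_num) hs.1
    · exact hc.stronglyMeasurableAtFilter isOpen_Ioi 0 (by simp)
    · exact hc.continuousAt (Ioi_mem_nhds (by norm_num))
  have hd' := hd.const_sub (∫ s in Ioi (-(1 / 2)), X ^ s / Gamma (s + 1))
  rw [rpow_zero, zero_add, Gamma_one, div_one] at hd'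
  refine hd'.congr_of_eventuallyEq ?_
  filter_upwards [lt_mem_nhds (show (-(1 / 2) : ℝ) < 0 by norm_num)] with a ha
  rw [← intervalIntegral.integral_Ioi_sub_Ioi hint ha.le, sub_sub_cancel]

/-- For all `x, λ > 0`:
`λ · ∫₀^x log(x−y) ν′(λ y) dy = −1 − (log λ + γ_EM) ν(λ x)`. -/
theorem volterra_log_convolution (x lam : ℝ) (hx : 0 < x) (hlam : 0 < lam) :
    lam * (∫ y in (0 : ℝ)..x, Real.log (x - y) * volterraDeriv (lam * y))
      = -1 - (Real.log lam + eulerGamma) * volterra (lam * x) := by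
  rw [intervalIntegral.integral_of_le hx.le, integral_Ioc_eq_integral_Ioo]
  have hG : HasDerivAt (fun a : ℝ => Gamma (a + 1)) (-eulerGamma) 0 := by
    rw [eulerGamma_eq_eulerMascheroniConstant]
    exact HasDerivAt.comp_add_const 0 1 (by simpa using hasDerivAt_Gamma_one)
  have hp : HasDerivAt (fun a : ℝ => lam ^ (-a)) (-log lam) 0 := by
    have := (hasDerivAt_neg (0 : ℝ)).const_rpow hlam
    simpa using this
  have hI := hasDerivAt_integral_Ioi_rpow_div_Gamma (mul_pos hlam hx)
  have hR := ((hG.mul hp).mul hI).const_mul lam⁻¹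
  have hL := hasDerivAt_integral_rpow_mul_volterraDeriv hx hlam
  have hL' := hR.congr_of_eventuallyEq (f₁ := fun a : ℝ =>
      ∫ y in Ioo 0 x, (x - y) ^ a * volterraDeriv (lam * y)) (by
    filter_upwards [lt_mem_nhds (show (-1 : ℝ) < 0 by norm_num)] with a ha
    exact integral_rpow_mul_volterraDeriv hx hlam ha)
  rw [hL.unique hL', volterra, mul_inv_cancel_left₀ hlam.ne']
  simp only [Pi.mul_apply, zero_add, Gamma_one, neg_zero, rpow_zero]
  ring
end
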